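/- Let n ≥ 1 be an integer and F(θ) = √(∑_{k=0}^{n−1} (cos θ)^{2k}). Consider the vector field X on ℝ³ given by X(θ,T,Q) = ( 3Q(T−1)·F(θ)²·sin(2θ)/(2n) − T·F(θ), 3Q(T−1)²·T·(1−(cos θ)^{2n})/n, −3(Q²−1)(T−1)(1−(cos θ)^{2n}) ). Then the point (θ,T,Q) = (0,0,1) is an equilibrium of X and it is unstable (it is not Lyapunov stable). -/

import Mathlib

open Real Filter

noncomputable section

/-- Lyapunov stability of the equilibrium `p` of the vector field `X` on the domain `D`. -/
def LyapunovStable {E : Type*} [NormedAddCommGroup E] [NormedSpace ℝ E]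
    (X : E → E) (D : Set E) (p : E) : Prop :=
  ∀ ε > 0, ∃ δ > 0, ∀ γ : ℝ → E,
    (∀ t : ℝ, 0 ≤ t → γ t ∈ D) →
    (∀ t : ℝ, 0 ≤ t → HasDerivAt γ (X (γ t)) t) →
    ‖γ 0 - p‖ < δ → ∀ t : ℝ, 0 ≤ t → ‖γ t - p‖ < ε

/-- `F θ = √(∑_{k=0}^{n-1} (cos θ)^{2k})`. -/
def F (n : ℕ) (θ : ℝ) : ℝ :=
  Real.sqrt (∑ k ∈ Finset.range n, Real.cos θ ^ (2 * k))

/-- The unwrapped vector field (flat, Λ ≠ 0, detailed balance, power-law potential);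
coordinates `(θ, T, Q)`. -/
def X8 (n : ℕ) (p : ℝ × ℝ × ℝ) : ℝ × ℝ × ℝ :=
  (3 * p.2.2 * (p.2.1 - 1) * F n p.1 ^ 2 * Real.sin (2 * p.1) / (2 * n) - p.2.1 * F n p.1,
   3 * p.2.2 * (p.2.1 - 1) ^ 2 * p.2.1 * (1 - Real.cos p.1 ^ (2 * n)) / n,
   -3 * (p.2.2 ^ 2 - 1) * (p.2.1 - 1) * (1 - Real.cos p.1 ^ (2 * n)))

/-- A bounded, globally Lipschitz autonomous vector field has a global integral curve through
every point. -/
theorem exists_global_integralCurve {E : Type*} [NormedAddCommGroup E] [NormedSpace ℝ E]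
    [CompleteSpace E] {v : E → E} {K L : NNReal} (hK : LipschitzWith K v) (hL : ∀ x, ‖v x‖ ≤ L)
    (x₀ : E) : ∃ γ : ℝ → E, γ 0 = x₀ ∧ ∀ t, HasDerivAt γ (v (γ t)) t := by
  have hloc : ∀ a : NNReal, ∃ γ : ℝ → E, γ 0 = x₀ ∧
      ∀ t ∈ Set.Ioo (-(a : ℝ)) a, HasDerivAt γ (v (γ t)) t := by
    intro a
    have h0 : (0 : ℝ) ∈ Set.Icc (-(a : ℝ)) a := ⟨by simp, a.2⟩
    have hPL : IsPicardLindelof (fun _ ↦ v) (⟨0, h0⟩ : Set.Icc (-(a : ℝ)) a) x₀ (L * a) 0 L K :=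
      .of_time_independent (fun x _ ↦ hL x) hK.lipschitzOnWith (by simp)
    obtain ⟨γ, h1, h2⟩ := hPL.exists_eq_forall_mem_Icc_hasDerivWithinAt₀
    exact ⟨γ, h1, fun t ht ↦
      (h2 t (Set.Ioo_subset_Icc_self ht)).hasDerivAt (Icc_mem_nhds ht.1 ht.2)⟩
  choose γ hγ0 hγ using hloc
  have hmono : ∀ a b : NNReal, a ≤ b → Set.EqOn (γ a) (γ b) (Set.Ioo (-(a : ℝ)) a) := by
    intro a b hab t ht
    have hab' : (a : ℝ) ≤ b := hab
    have ha : (0 : ℝ) < a := by linarith [ht.1, ht.2]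
    exact ODE_solution_unique_of_mem_Ioo (v := fun _ ↦ v) (s := fun _ ↦ Set.univ) (K := K)
      (t₀ := 0) (fun _ _ ↦ hK.lipschitzOnWith) ⟨by linarith, ha⟩
      (fun s hs ↦ ⟨hγ a s hs, trivial⟩)
      (fun s hs ↦ ⟨hγ b s ⟨by linarith [hs.1], by linarith [hs.2]⟩, trivial⟩)
      ((hγ0 a).trans (hγ0 b).symm) ht
  have hagree : ∀ a : NNReal, ∀ t ∈ Set.Ioo (-(a : ℝ)) a, γ (‖t‖₊ + 1) t = γ a t := by
    intro a t ht
    rcases le_total a (‖t‖₊ + 1) with h | h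
    · exact (hmono _ _ h ht).symm
    · refine hmono _ _ h ?_
      simp only [NNReal.coe_add, coe_nnnorm, NNReal.coe_one, Real.norm_eq_abs]
      exact ⟨by linarith [neg_abs_le t], by linarith [le_abs_self t]⟩
  refine ⟨fun t ↦ γ (‖t‖₊ + 1) t, hγ0 _, fun t ↦ ?_⟩
  have ht : t ∈ Set.Ioo (-((‖t‖₊ + 1 : NNReal) : ℝ)) (‖t‖₊ + 1 : NNReal) := by
    simp only [NNReal.coe_add, coe_nnnorm, NNReal.coe_one, Real.norm_eq_abs]
    exact ⟨by linarith [neg_abs_le t], by linarith [le_abs_self t]⟩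
  refine (hγ _ t ht).congr_of_eventuallyEq ?_
  filter_upwards [Ioo_mem_nhds ht.1 ht.2] with s hs using hagree _ s hs

theorem hasDerivAt_fst_comp {E G : Type*} [NormedAddCommGroup E] [NormedSpace ℝ E]
    [NormedAddCommGroup G] [NormedSpace ℝ G] {γ : ℝ → E × G} {γ' : E × G} {t : ℝ}
    (h : HasDerivAt γ γ' t) : HasDerivAt (fun s ↦ (γ s).1) γ'.1 t :=
  (ContinuousLinearMap.fst ℝ E G).hasFDerivAt.comp_hasDerivAt t h

theorem hasDerivAt_snd_comp {E G : Type*} [NormedAddCommGroup E] [NormedSpace ℝ E]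
    [NormedAddCommGroup G] [NormedSpace ℝ G] {γ : ℝ → E × G} {γ' : E × G} {t : ℝ}
    (h : HasDerivAt γ γ' t) : HasDerivAt (fun s ↦ (γ s).2) γ'.2 t :=
  (ContinuousLinearMap.snd ℝ E G).hasFDerivAt.comp_hasDerivAt t h

theorem one_le_sum_pow_two_mul {n : ℕ} (hn : 1 ≤ n) (c : ℝ) :
    1 ≤ ∑ k ∈ Finset.range n, c ^ (2 * k) := by
  have h := Finset.single_le_sum (f := fun k ↦ c ^ (2 * k))
    (fun k _ ↦ (even_two_mul k).pow_nonneg c) (Finset.mem_range.2 (show 0 < n by omega))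
  simpa using h

theorem one_le_F {n : ℕ} (hn : 1 ≤ n) (θ : ℝ) : 1 ≤ F n θ :=
  Real.one_le_sqrt.2 (one_le_sum_pow_two_mul hn _)

theorem F_sq_le (n : ℕ) (θ : ℝ) : F n θ ^ 2 ≤ n := by
  rw [F, Real.sq_sqrt (Finset.sum_nonneg fun k _ ↦ (even_two_mul k).pow_nonneg _)]
  calc ∑ k ∈ Finset.range n, Real.cos θ ^ (2 * k) ≤ ∑ _k ∈ Finset.range n, (1 : ℝ) := by
        refine Finset.sum_le_sum fun k _ ↦ ?_
        rw [pow_mul]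
        exact pow_le_one₀ (sq_nonneg _) (Real.cos_sq_le_one θ)
    _ = n := by simp

/-- The restriction of `X8 n` to the invariant plane `Q = 1`, with `T = sin² u`, written as a
function of `((cos θ, sin θ), (cos u, sin u))`. -/
def trigField (n : ℕ) (z : (ℝ × ℝ) × (ℝ × ℝ)) : ℝ × ℝ :=
  (3 * (z.2.2 ^ 2 - 1) * Real.sqrt (∑ k ∈ Finset.range n, z.1.1 ^ (2 * k)) ^ 2 *
      (2 * z.1.2 * z.1.1) / (2 * n) -
    z.2.2 ^ 2 * Real.sqrt (∑ k ∈ Finset.range n, z.1.1 ^ (2 * k)),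
   3 / 2 * z.2.1 ^ 3 * z.2.2 * (1 - z.1.1 ^ (2 * n)) / n)

theorem contDiff_trigField {n : ℕ} (hn : 1 ≤ n) : ContDiff ℝ 1 (trigField n) := by
  have hF : ContDiff ℝ 1 fun z : (ℝ × ℝ) × (ℝ × ℝ) ↦
      Real.sqrt (∑ k ∈ Finset.range n, z.1.1 ^ (2 * k)) := by
    refine ContDiff.sqrt (by fun_prop) fun z ↦ ?_
    linarith [one_le_sum_pow_two_mul hn z.1.1]
  unfold trigField
  fun_prop

def trigMap (p : ℝ × ℝ) : (ℝ × ℝ) × (ℝ × ℝ) :=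
  ((Real.cos p.1, Real.sin p.1), (Real.cos p.2, Real.sin p.2))

theorem lipschitzWith_trigMap : LipschitzWith 1 trigMap := by
  have hc : LipschitzWith 1 Real.cos := Real.lipschitzWith_cos
  have hs : LipschitzWith 1 Real.sin := Real.lipschitzWith_sin
  have h1 : LipschitzWith 1 (Prod.fst : ℝ × ℝ → ℝ) := LipschitzWith.prod_fst
  have h2 : LipschitzWith 1 (Prod.snd : ℝ × ℝ → ℝ) := LipschitzWith.prod_snd
  have htrig : trigMap = fun p ↦ ((Real.cos p.1, Real.sin p.1), (Real.cos p.2, Real.sin p.2)) := rfl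
  simpa [htrig] using
    ((hc.comp h1).prodMk (hs.comp h1)).prodMk ((hc.comp h2).prodMk (hs.comp h2))

theorem trigMap_mem (p : ℝ × ℝ) : trigMap p ∈ Metric.closedBall (0 : (ℝ × ℝ) × (ℝ × ℝ)) 1 := by
  simp [trigMap, Prod.norm_def, Real.abs_cos_le_one, Real.abs_sin_le_one]

theorem exists_curve_X8 {n : ℕ} (hn : 1 ≤ n) (u₀ : ℝ) :
    ∃ θ T : ℝ → ℝ, θ 0 = 0 ∧ T 0 = Real.sin u₀ ^ 2 ∧ (∀ t, 0 ≤ T t) ∧ (∀ t, T t ≤ 1) ∧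
      ∀ t, HasDerivAt (fun s ↦ (θ s, T s, (1 : ℝ))) (X8 n (θ t, T t, 1)) t := by
  have hG := contDiff_trigField hn
  have hB := isCompact_closedBall (0 : (ℝ × ℝ) × (ℝ × ℝ)) 1
  obtain ⟨K, hK⟩ := hG.contDiffOn.exists_lipschitzOnWith one_ne_zero (convex_closedBall _ 1) hB
  obtain ⟨C, hC⟩ := hB.exists_bound_of_continuousOn hG.continuous.continuousOn
  have hLip : LipschitzWith (K * 1) (trigField n ∘ trigMap) :=
    lipschitzOnWith_univ.1
      (hK.comp lipschitzWith_trigMap.lipschitzOnWith fun p _ ↦ trigMap_mem p)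
  obtain ⟨γ, hγ0, hγ⟩ := exists_global_integralCurve hLip (L := C.toNNReal)
    (fun p ↦ (hC _ (trigMap_mem p)).trans (Real.le_coe_toNNReal C)) (0, u₀)
  refine ⟨fun t ↦ (γ t).1, fun t ↦ Real.sin (γ t).2 ^ 2, by simp [hγ0], by simp [hγ0],
    fun t ↦ sq_nonneg _, fun t ↦ Real.sin_sq_le_one _, fun t ↦ ?_⟩
  have h1 : HasDerivAt (fun s ↦ (γ s).1) _ t := hasDerivAt_fst_comp (hγ t)
  have h2 : HasDerivAt (fun s ↦ (γ s).2) _ t := hasDerivAt_snd_comp (hγ t)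
  refine (h1.prodMk ((h2.sin.pow 2).prodMk (hasDerivAt_const t (1 : ℝ)))).congr_deriv ?_
  simp only [X8, F, trigField, trigMap, Function.comp, Real.sin_two_mul]
  refine Prod.ext (by simp) (Prod.ext ?_ (by simp))
  have hcs : Real.sin (γ t).2 ^ 2 - 1 = -Real.cos (γ t).2 ^ 2 := by
    linarith [Real.sin_sq_add_cos_sq (γ t).2]
  simp only [hcs]
  push_cast
  ring

theorem stmt_8 (n : ℕ) (hn : 1 ≤ n) :
    X8 n (0, 0, 1) = (0, 0, 0) ∧
      ¬ LyapunovStable (X8 n) (Set.univ : Set (ℝ × ℝ × ℝ)) (0, 0, 1) := by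
  have hn0 : (0 : ℝ) < n := by exact_mod_cast hn
  refine ⟨by simp [X8], fun hst ↦ ?_⟩
  obtain ⟨δ, hδ, hst⟩ := hst (1 / 2) (by norm_num)
  set u₀ : ℝ := min δ 1 / 2 with hu₀
  have hu0 : 0 < u₀ := by positivity
  have hu1 : u₀ ≤ 1 / 2 := by linarith [min_le_right δ 1]
  have huδ : u₀ < δ := by linarith [min_le_left δ 1, lt_min hδ one_pos]
  have hs0 : 0 < Real.sin u₀ := Real.sin_pos_of_pos_of_lt_pi hu0 (by linarith [Real.pi_gt_three])
  have hsu : Real.sin u₀ < u₀ := Real.sin_lt hu0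
  obtain ⟨θ, T, hθ0, hT0, hTnn, hT1, hder⟩ := exists_curve_X8 hn u₀
  set τ := Real.sin u₀ ^ 2 with hτ
  have hτ0 : 0 < τ := by positivity
  have hτδ : τ < δ := by nlinarith
  have hclose := hst (fun s ↦ (θ s, T s, 1)) (fun _ _ ↦ trivial) (fun t _ ↦ hder t) (by
    simp [Prod.norm_def, hθ0, hT0, abs_of_pos hτ0, hτδ, hδ])
  have hbd : ∀ t, 0 ≤ t → |θ t| < 1 / 2 ∧ |T t| < 1 / 2 := by
    intro t ht
    simpa [Prod.norm_def] using hclose t ht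
  have hθd : ∀ t, HasDerivAt θ (X8 n (θ t, T t, 1)).1 t := fun t ↦
    hasDerivAt_fst_comp (hder t)
  have hTd : ∀ t, HasDerivAt T (X8 n (θ t, T t, 1)).2.1 t := fun t ↦
    hasDerivAt_fst_comp (hasDerivAt_snd_comp (hder t))
  have hcos : ∀ x, Real.sin x ^ 2 ≤ 1 - Real.cos x ^ (2 * n) := by
    intro x
    have h : Real.cos x ^ (2 * n) ≤ Real.cos x ^ 2 := by
      rw [pow_mul]
      exact pow_le_of_le_one (sq_nonneg _) (Real.cos_sq_le_one x) (by omega)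
    linarith [Real.sin_sq_add_cos_sq x]
  have hTmono : Monotone T := by
    refine monotone_of_hasDerivAt_nonneg hTd fun t ↦ ?_
    have h1 := (sq_nonneg _).trans (hcos (θ t))
    have h2 := hTnn t
    simp only [X8, Pi.zero_apply]
    positivity
  have hTτ : ∀ t, 0 ≤ t → τ ≤ T t := fun t ht ↦ hT0 ▸ hTmono ht
  -- The functional `6 n / τ² · T - θ` grows at least linearly along the curve.
  have hgrow : ∀ t, 0 ≤ t →
      τ / 2 ≤ 6 * n / τ ^ 2 * (X8 n (θ t, T t, 1)).2.1 - (X8 n (θ t, T t, 1)).1 := by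
    intro t ht
    have hTt := hTτ t ht
    have hTh := (abs_lt.1 (hbd t ht).2).2
    set x := θ t
    set S := Real.sin x
    have hX2 : 3 / 4 * τ * S ^ 2 / n ≤ (X8 n (x, T t, 1)).2.1 := by
      simp only [X8]
      have hq : 1 / 4 ≤ (T t - 1) ^ 2 := by nlinarith
      have hqT : 1 / 4 * τ ≤ (T t - 1) ^ 2 * T t := by gcongr
      have := mul_le_mul hqT (hcos x) (sq_nonneg _)
        (mul_nonneg (sq_nonneg _) (hTnn t))
      refine (div_le_div_iff_of_pos_right hn0).2 ?_
      linarith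
    have hX1 : (X8 n (x, T t, 1)).1 ≤ 3 * |S| - τ := by
      simp only [X8]
      have hF1 := one_le_F hn x
      have hTF : τ ≤ T t * F n x := by nlinarith
      have hFn : F n x ^ 2 / n ≤ 1 := (div_le_one hn0).2 (F_sq_le n x)
      have habs : |(T t - 1) * (F n x ^ 2 / n) * (S * Real.cos x)| ≤ |S| := by
        rw [abs_mul, abs_mul, abs_mul S]
        have ha : |T t - 1| ≤ 1 := abs_le.2 ⟨by linarith, by linarith⟩
        have hb : |F n x ^ 2 / n| ≤ 1 := by rwa [abs_of_nonneg (by positivity)]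
        have hc := Real.abs_cos_le_one x
        calc |T t - 1| * |F n x ^ 2 / n| * (|S| * |Real.cos x|) ≤ 1 * 1 * (|S| * 1) := by gcongr
          _ = |S| := by ring
      have he : 3 * 1 * (T t - 1) * F n x ^ 2 * Real.sin (2 * x) / (2 * n) =
          3 * ((T t - 1) * (F n x ^ 2 / n) * (S * Real.cos x)) := by
        rw [Real.sin_two_mul]
        field_simp
        ring
      rw [he]
      linarith [le_abs_self ((T t - 1) * (F n x ^ 2 / n) * (S * Real.cos x))]
    have hX2' : 9 / (2 * τ) * S ^ 2 ≤ 6 * n / τ ^ 2 * (X8 n (x, T t, 1)).2.1 := by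
      calc 9 / (2 * τ) * S ^ 2 = 6 * n / τ ^ 2 * (3 / 4 * τ * S ^ 2 / n) := by
            field_simp
            ring
        _ ≤ _ := by gcongr
    have ham : 3 * |S| ≤ τ / 2 + 9 / (2 * τ) * S ^ 2 := by
      rw [← sub_nonneg, ← sq_abs S]
      have : τ / 2 + 9 / (2 * τ) * |S| ^ 2 - 3 * |S| = (τ - 3 * |S|) ^ 2 / (2 * τ) := by
        field_simp
        ring
      rw [this]
      positivity
    linarith
  set W : ℝ → ℝ := fun t ↦ 6 * n / τ ^ 2 * T t - θ t - τ / 2 * t with hW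
  have hWd : ∀ t, HasDerivAt W (6 * n / τ ^ 2 * (X8 n (θ t, T t, 1)).2.1 -
      (X8 n (θ t, T t, 1)).1 - τ / 2) t := fun t ↦
    ((((hTd t).const_mul (6 * n / τ ^ 2)).sub (hθd t)).sub
      ((hasDerivAt_id t).const_mul (τ / 2))).congr_deriv (by simp)
  have hWmono : MonotoneOn W (Set.Ici 0) := by
    refine monotoneOn_of_deriv_nonneg (convex_Ici 0)
      (fun t _ ↦ (hWd t).continuousAt.continuousWithinAt)
      (fun t _ ↦ (hWd t).differentiableAt.differentiableWithinAt) fun t ht ↦ ?_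
    rw [(hWd t).deriv]
    linarith [hgrow t (interior_subset ht)]
  set C : ℝ := 6 * n / τ ^ 2 with hC
  have hC0 : 0 < C := by positivity
  set t₁ : ℝ := (C + 1) * 2 / τ with ht₁
  have ht₁0 : 0 ≤ t₁ := by positivity
  have hfin := hWmono (Set.mem_Ici.2 le_rfl) (Set.mem_Ici.2 ht₁0) ht₁0
  have htt : τ / 2 * t₁ = C + 1 := by
    rw [ht₁]
    field_simp
  simp only [hW, hθ0, hT0, htt] at hfin
  have hθ1 := abs_lt.1 (hbd t₁ ht₁0).1
  have hmul : C * T t₁ ≤ C * 1 := by gcongr; exact hT1 t₁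
  have hpos : 0 < C * τ := by positivity
  linarith [hθ1.1]
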